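/- arXiv:0708.0419 — 3 statements merged into one kernel-verified Lean document; each statement's English description precedes it below -/
import Mathlib

section
/- Let F₂ = ℤ/2ℤ, let E := {v : Fin 8 → F₂ | Σᵢ v(i) = 0} be the subspace of even-weight vectors, let 𝟙 ∈ E be the all-ones vector, J := F₂·𝟙, and W := E/J. Define q̃ : E → F₂ by q̃(v) = (|supp(v)|/2) mod 2, where |supp(v)| is the (even) number of coordinates i with v(i) = 1. Then: (i) q̃(v + 𝟙) = q̃(v) for all v ∈ E, so q̃ descends to a function q : W → F₂; (ii) every permutation σ of Fin 8 acts on E by permuting coordinates, preserves J and q̃, and hence induces an F₂-linear automorphism Φ(σ) of W with q∘Φ(σ) = q; (iii) the resulting group homomorphism Φ from the symmetric group S₈ = Perm(Fin 8) to O(W, q) := {f : W → W | f is an F₂-linear bijection and q∘f = q} is bijective, so O(W, q) ≅ S₈. -/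
/-- The `F₂`-linear functional on `F₂⁸` summing the coordinates. -/
def sumF : (Fin 8 → ZMod 2) →ₗ[ZMod 2] ZMod 2 where
  toFun v := ∑ i, v i
  map_add' v w := by simp [Finset.sum_add_distrib]
  map_smul' c v := by simp [Finset.mul_sum]

/-- The subspace `E ⊆ F₂⁸` of even-weight vectors. -/
def Esub : Submodule (ZMod 2) (Fin 8 → ZMod 2) := LinearMap.ker sumF

/-- The all-ones vector `𝟙`, as an element of `E`. -/
def oneE : Esub := ⟨fun _ => 1, by
  show sumF (fun _ => 1) = 0
  show (∑ _i : Fin 8, (1 : ZMod 2)) = 0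
  decide⟩

/-- The line `J = F₂·𝟙 ⊆ E`. -/
def Jsub : Submodule (ZMod 2) Esub := Submodule.span (ZMod 2) {oneE}

/-- `q̃ : E → F₂`, half the cardinality of the support, modulo 2. -/
def qt (v : Esub) : ZMod 2 :=
  (((Finset.univ.filter fun i => (v : Fin 8 → ZMod 2) i = 1).card / 2 : ℕ) : ZMod 2)

/-- The action of a permutation `σ` of the 8 coordinates on `E`. -/
def permE (σ : Equiv.Perm (Fin 8)) : Esub →ₗ[ZMod 2] Esub where
  toFun v := ⟨fun j => (v : Fin 8 → ZMod 2) (σ.symm j), by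
    show sumF (fun j => (v : Fin 8 → ZMod 2) (σ.symm j)) = 0
    show (∑ j, (v : Fin 8 → ZMod 2) (σ.symm j)) = 0
    rw [Equiv.sum_comp σ.symm]
    exact v.2⟩
  map_add' v w := rfl
  map_smul' c v := rfl

lemma qt_zmod (x : ZMod 2) : x = 0 ∨ x = 1 := by
  revert x; decide

lemma mem_Esub_iff (v : Fin 8 → ZMod 2) : v ∈ Esub ↔ ∑ i, v i = 0 := Iff.rfl

/-- the support of `v` -/
def suppE (v : Fin 8 → ZMod 2) : Finset (Fin 8) := Finset.univ.filter fun i => v i = 1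

lemma mem_suppE (v : Fin 8 → ZMod 2) (i : Fin 8) : i ∈ suppE v ↔ v i = 1 := by
  simp [suppE]

lemma even_suppE (v : Esub) : Even (suppE v).card := by
  have h : ∑ i, (v : Fin 8 → ZMod 2) i = 0 := v.2
  have h2 : ∑ i, (v : Fin 8 → ZMod 2) i = ((suppE v).card : ZMod 2) := by
    rw [suppE, Finset.card_filter]
    push_cast
    refine Finset.sum_congr rfl fun i _ => ?_
    rcases qt_zmod ((v : Fin 8 → ZMod 2) i) with h | h <;> simp [h]
  rw [h2] at h
  exact (ZMod.natCast_eq_zero_iff_even).1 h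

lemma qt_eq (v : Esub) : qt v = (((suppE v).card / 2 : ℕ) : ZMod 2) := rfl

lemma suppE_add_one (v : Esub) : suppE ((v + oneE : Esub) : Fin 8 → ZMod 2) = (suppE v)ᶜ := by
  ext i
  rw [Finset.mem_compl, mem_suppE, mem_suppE]
  show (v : Fin 8 → ZMod 2) i + 1 = 1 ↔ _
  rcases qt_zmod ((v : Fin 8 → ZMod 2) i) with h | h <;> simp [h]

lemma qt_add_one (v : Esub) : qt (v + oneE) = qt v := by
  rw [qt_eq, qt_eq, suppE_add_one, Finset.card_compl, Fintype.card_fin]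
  have h := even_suppE v
  have h8 : (suppE v).card ≤ 8 := by simpa using Finset.card_le_univ (suppE v)
  generalize (suppE v).card = n at *
  interval_cases n <;> first | (exfalso; revert h; decide) | decide

lemma mk_eq_iff (v w : Esub) :
    (Submodule.Quotient.mk v : Esub ⧸ Jsub) = Submodule.Quotient.mk w ↔ v = w ∨ v = w + oneE := by
  rw [Submodule.Quotient.eq, Jsub, Submodule.mem_span_singleton]
  constructor
  · rintro ⟨c, hc⟩
    rcases qt_zmod c with rfl | rfl
    · left
      rw [zero_smul] at hc
      exact sub_eq_zero.1 hc.symm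
    · right
      rw [one_smul] at hc
      rw [hc]; abel
  · rintro (rfl | rfl)
    · exact ⟨0, by simp⟩
    · exact ⟨1, by simp⟩

/-- the descended form -/
noncomputable def qW (w : Esub ⧸ Jsub) : ZMod 2 := qt (Quotient.out w)

lemma qW_mk (v : Esub) : qW (Submodule.Quotient.mk v) = qt v := by
  have h : (Submodule.Quotient.mk (Quotient.out (Submodule.Quotient.mk v : Esub ⧸ Jsub)) :
      Esub ⧸ Jsub) = Submodule.Quotient.mk v := Quotient.out_eq _
  rw [mk_eq_iff] at h
  unfold qW
  rcases h with h | h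
  · rw [h]
  · rw [h, qt_add_one]

lemma qt_permE (σ : Equiv.Perm (Fin 8)) (v : Esub) : qt (permE σ v) = qt v := by
  have : suppE (permE σ v : Esub) = (suppE v).map σ.toEmbedding := by
    ext i
    rw [Finset.mem_map_equiv, mem_suppE, mem_suppE]
    rfl
  rw [qt_eq, qt_eq, this, Finset.card_map]

lemma permE_one (σ : Equiv.Perm (Fin 8)) : permE σ oneE = oneE := rfl

lemma map_permE (σ : Equiv.Perm (Fin 8)) : Submodule.map (permE σ) Jsub = Jsub := by
  rw [Jsub, Submodule.map_span, Set.image_singleton, permE_one]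

/-- `permE` as an equivalence -/
def permEquiv (σ : Equiv.Perm (Fin 8)) : Esub ≃ₗ[ZMod 2] Esub :=
  LinearEquiv.ofLinearMap (permE σ) (permE σ.symm)
    (by ext v i; simp [permE]) (by ext v i; simp [permE])

/-- the homomorphism -/
def PhiW : Equiv.Perm (Fin 8) →* ((Esub ⧸ Jsub) ≃ₗ[ZMod 2] (Esub ⧸ Jsub)) where
  toFun σ := Submodule.Quotient.equiv Jsub Jsub (permEquiv σ) (map_permE σ)
  map_one' := by
    ext w
    obtain ⟨v, rfl⟩ := Submodule.Quotient.mk_surjective _ w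
    rfl
  map_mul' σ τ := by
    ext w
    obtain ⟨v, rfl⟩ := Submodule.Quotient.mk_surjective _ w
    rfl

lemma PhiW_mk (σ : Equiv.Perm (Fin 8)) (v : Esub) :
    PhiW σ (Submodule.Quotient.mk v) = Submodule.Quotient.mk (permE σ v) := rfl

/-- the vector `e_a + e_b` -/
def pairE (a b : Fin 8) : Esub := ⟨Pi.single a 1 + Pi.single b 1, by
  rw [mem_Esub_iff]
  simp only [Pi.add_apply, Finset.sum_add_distrib, Finset.sum_pi_single', Finset.mem_univ, if_true]
  decide⟩

lemma pairE_apply (a b i : Fin 8) : (pairE a b : Fin 8 → ZMod 2) i =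
    (if i = a then 1 else 0) + (if i = b then 1 else 0) := by
  simp [pairE, Pi.single_apply]

lemma suppE_pairE {a b : Fin 8} (h : a ≠ b) : suppE (pairE a b) = {a, b} := by
  ext i
  rw [mem_suppE, pairE_apply, Finset.mem_insert, Finset.mem_singleton]
  by_cases h1 : i = a <;> by_cases h2 : i = b <;> simp_all

lemma permE_pairE (σ : Equiv.Perm (Fin 8)) (a b : Fin 8) :
    permE σ (pairE a b) = pairE (σ a) (σ b) := by
  apply Subtype.ext
  funext i
  rw [pairE_apply]
  show (pairE a b : Fin 8 → ZMod 2) (σ.symm i) = _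
  rw [pairE_apply]
  simp only [Equiv.symm_apply_eq]

lemma qt_pairE {a b : Fin 8} (h : a ≠ b) : qt (pairE a b) = 1 := by
  rw [qt_eq, suppE_pairE h, Finset.card_pair h]; rfl

lemma suppE_inj {v w : Esub} (h : suppE v = suppE w) : v = w := by
  apply Subtype.ext
  funext i
  have h1 : i ∈ suppE v ↔ i ∈ suppE w := by rw [h]
  rw [mem_suppE, mem_suppE] at h1
  rcases qt_zmod ((v : Fin 8 → ZMod 2) i) with h | h <;>
    rcases qt_zmod ((w : Fin 8 → ZMod 2) i) with h' | h' <;> simp_all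

lemma exists_pair_of_qt {v : Esub} (hv : qt v = 1) :
    ∃ a b, a ≠ b ∧ (Submodule.Quotient.mk v : Esub ⧸ Jsub) = Submodule.Quotient.mk (pairE a b) := by
  have h := even_suppE v
  have h8 : (suppE v).card ≤ 8 := by simpa using Finset.card_le_univ (suppE v)
  have hc : (suppE v)ᶜ.card = 8 - (suppE v).card := by
    rw [Finset.card_compl, Fintype.card_fin]
  have key : (suppE v).card = 2 ∨ (suppE v).card = 6 := by
    rw [qt_eq] at hv
    generalize (suppE v).card = n at *
    clear hc
    interval_cases n <;> first | (exfalso; revert h; decide) | (exfalso; revert hv; decide) | decide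
  rcases key with h2 | h2
  · obtain ⟨a, b, hab, hs⟩ := Finset.card_eq_two.1 h2
    exact ⟨a, b, hab, by rw [suppE_inj (hs.trans (suppE_pairE hab).symm)]⟩
  · rw [h2] at hc
    obtain ⟨a, b, hab, hs⟩ := Finset.card_eq_two.1 hc
    refine ⟨a, b, hab, ?_⟩
    rw [← suppE_add_one] at hs
    rw [← suppE_inj (hs.trans (suppE_pairE hab).symm), eq_comm, mk_eq_iff]
    right; rfl

lemma exists_pair_of_qW {w : Esub ⧸ Jsub} (hw : qW w = 1) :
    ∃ a b, a ≠ b ∧ w = Submodule.Quotient.mk (pairE a b) := by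
  obtain ⟨v, rfl⟩ := Submodule.Quotient.mk_surjective _ w
  rw [qW_mk] at hw
  exact exists_pair_of_qt hw

lemma meet_of_qt {a b c d : Fin 8} (hab : a ≠ b) (hcd : c ≠ d)
    (h : qt (pairE a b + pairE c d) = 1) : a = c ∨ a = d ∨ b = c ∨ b = d := by
  by_contra! hne
  obtain ⟨h1, h2, h3, h4⟩ := hne
  have : suppE ((pairE a b + pairE c d : Esub) : Fin 8 → ZMod 2) = {a, b, c, d} := by
    ext i
    rw [mem_suppE]
    show (pairE a b : Fin 8 → ZMod 2) i + (pairE c d : Fin 8 → ZMod 2) i = 1 ↔ _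
    rw [pairE_apply, pairE_apply]
    simp only [Finset.mem_insert, Finset.mem_singleton]
    by_cases i1 : i = a <;> by_cases i2 : i = b <;> by_cases i3 : i = c <;>
      by_cases i4 : i = d <;> simp_all
  rw [qt_eq, this] at h
  have h4 : ({a, b, c, d} : Finset (Fin 8)).card = 4 := by
    rw [Finset.card_eq_succ]
    refine ⟨a, {b, c, d}, by simp_all, rfl, ?_⟩
    rw [Finset.card_eq_three]
    exact ⟨b, c, d, h3, h4, hcd, rfl⟩
  rw [h4] at h
  revert h; decide

lemma pair_inj {a b c d : Fin 8} (hab : a ≠ b) (hcd : c ≠ d)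
    (h : (Submodule.Quotient.mk (pairE a b) : Esub ⧸ Jsub) = Submodule.Quotient.mk (pairE c d)) :
    (a = c ∧ b = d) ∨ (a = d ∧ b = c) := by
  rw [mk_eq_iff] at h
  rcases h with h | h
  · have h1 := congrArg (fun v : Esub => suppE v) h
    simp only [suppE_pairE hab, suppE_pairE hcd] at h1
    have ha : a ∈ ({c, d} : Finset (Fin 8)) := by rw [← h1]; simp
    have hb : b ∈ ({c, d} : Finset (Fin 8)) := by rw [← h1]; simp
    simp only [Finset.mem_insert, Finset.mem_singleton] at ha hb
    grind
  · exfalso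
    have h1 := congrArg (fun v : Esub => (suppE v).card) h
    simp only [suppE_add_one, suppE_pairE hab, suppE_pairE hcd, Finset.card_compl,
      Finset.card_pair hab, Finset.card_pair hcd, Fintype.card_fin] at h1
    omega

lemma mk_pairE_swap (a b : Fin 8) : pairE a b = pairE b a := by
  apply Subtype.ext; funext i; rw [pairE_apply, pairE_apply, add_comm]

lemma PhiW_injective : Function.Injective PhiW := by
  rw [injective_iff_map_eq_one]
  intro σ hσ
  have key : ∀ i j, i ≠ j → (σ i = i ∧ σ j = j) ∨ (σ i = j ∧ σ j = i) := by
    intro i j hij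
    apply pair_inj (fun h => hij (σ.injective h)) hij
    rw [← permE_pairE, ← PhiW_mk, hσ]
    rfl
  ext1 i
  obtain ⟨j, k, hij, hik, hjk⟩ : ∃ j k : Fin 8, i ≠ j ∧ i ≠ k ∧ j ≠ k := by
    revert i; decide
  have h1 := key i j hij
  have h2 := key i k hik
  show σ i = i
  grind

lemma sum_pairE (v : Esub) : v = ∑ j, (v : Fin 8 → ZMod 2) j • pairE 0 j := by
  apply Subtype.ext
  funext i
  have hv : ∑ i, (v : Fin 8 → ZMod 2) i = 0 := v.2
  simp only [Submodule.coe_sum, Submodule.coe_smul, Finset.sum_apply, Pi.smul_apply, pairE_apply,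
    smul_eq_mul, mul_add, Finset.sum_add_distrib, ← Finset.sum_mul, hv]
  simp

lemma triangle {a b c d e x y : Fin 8} (hab : a ≠ b) (hac : a ≠ c) (hbc : b ≠ c)
    (hde : d ≠ e) (hxy : x ≠ y) (hda : d ≠ a) (hea : e ≠ a)
    (h1 : d = b ∨ e = b) (h2 : d = c ∨ e = c)
    (h3 : x = a ∨ x = b ∨ y = a ∨ y = b)
    (h4 : x = a ∨ x = c ∨ y = a ∨ y = c)
    (h5 : x = d ∨ x = e ∨ y = d ∨ y = e)
    (n1 : ¬ ((x = a ∧ y = b) ∨ (x = b ∧ y = a)))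
    (n2 : ¬ ((x = a ∧ y = c) ∨ (x = c ∧ y = a)))
    (n3 : ¬ ((x = d ∧ y = e) ∨ (x = e ∧ y = d))) : False := by
  grind

lemma common_point (p r : Fin 8 → Fin 8) (hpr : ∀ j, j ≠ 0 → p j ≠ r j)
    (hm : ∀ j k, j ≠ 0 → k ≠ 0 → j ≠ k → p j = p k ∨ p j = r k ∨ r j = p k ∨ r j = r k)
    (hn : ∀ j k, j ≠ 0 → k ≠ 0 → j ≠ k → ¬ ((p j = p k ∧ r j = r k) ∨ (p j = r k ∧ r j = p k))) :
    ∃ c, ∀ j, j ≠ 0 → p j = c ∨ r j = c := by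
  have h12 : ∃ a b c, a ≠ b ∧ a ≠ c ∧ b ≠ c ∧ ((p 1 = a ∧ r 1 = b) ∨ (p 1 = b ∧ r 1 = a)) ∧
      ((p 2 = a ∧ r 2 = c) ∨ (p 2 = c ∧ r 2 = a)) := by
    have := hm 1 2 (by decide) (by decide) (by decide)
    have n := hn 1 2 (by decide) (by decide) (by decide)
    have n1 := hpr 1 (by decide)
    have n2 := hpr 2 (by decide)
    rcases this with h | h | h | h
    · exact ⟨p 1, r 1, r 2, by grind⟩
    · exact ⟨p 1, r 1, p 2, by grind⟩
    · exact ⟨r 1, p 1, r 2, by grind⟩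
    · exact ⟨r 1, p 1, p 2, by grind⟩
  obtain ⟨a, b, c, hab, hac, hbc, h1, h2⟩ := h12
  refine ⟨a, fun j hj => ?_⟩
  by_contra! hcon
  have hj1 : j ≠ 1 := by rintro rfl; grind
  have hj2 : j ≠ 2 := by rintro rfl; grind
  obtain ⟨k, hk0, hk1, hk2, hkj⟩ : ∃ k : Fin 8, k ≠ 0 ∧ k ≠ 1 ∧ k ≠ 2 ∧ k ≠ j := by
    clear * -; revert j; decide
  have m1 := hm j 1 hj (by decide) hj1
  have m2 := hm j 2 hj (by decide) hj2
  have m3 := hm k 1 hk0 (by decide) hk1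
  have m4 := hm k 2 hk0 (by decide) hk2
  have m5 := hm k j hk0 hj hkj
  have n1 := hn k 1 hk0 (by decide) hk1
  have n2 := hn k 2 hk0 (by decide) hk2
  have n3 := hn k j hk0 hj hkj
  refine triangle hab hac hbc (hpr j hj) (hpr k hk0) hcon.1 hcon.2 ?_ ?_ ?_ ?_ m5 ?_ ?_ n3 <;>
    clear hm hn hpr m5 n3 <;> grind

lemma PhiW_surj (f : (Esub ⧸ Jsub) ≃ₗ[ZMod 2] (Esub ⧸ Jsub)) (hf : ∀ w, qW (f w) = qW w) :
    ∃ σ, PhiW σ = f := by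
  have h0 : ∀ j : Fin 8, ∃ a b, j ≠ 0 → a ≠ b ∧
      f (Submodule.Quotient.mk (pairE 0 j)) = Submodule.Quotient.mk (pairE a b) := by
    intro j
    by_cases hj : j = 0
    · exact ⟨0, 0, fun h => absurd hj h⟩
    · obtain ⟨a, b, h⟩ := exists_pair_of_qW (w := f (Submodule.Quotient.mk (pairE 0 j)))
        (by rw [hf, qW_mk, qt_pairE (Ne.symm hj)])
      exact ⟨a, b, fun _ => h⟩
  choose p r hp using h0
  obtain ⟨c, hc⟩ := common_point p r (fun j hj => (hp j hj).1)
    (by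
      intro j k hj hk hjk
      apply meet_of_qt (hp j hj).1 (hp k hk).1
      rw [← qW_mk, Submodule.Quotient.mk_add, ← (hp j hj).2, ← (hp k hk).2, ← map_add, hf,
        ← Submodule.Quotient.mk_add, qW_mk]
      have : pairE 0 j + pairE 0 k = pairE j k := by
        apply Subtype.ext
        funext i
        show (pairE 0 j : Fin 8 → ZMod 2) i + (pairE 0 k : Fin 8 → ZMod 2) i = _
        rw [pairE_apply, pairE_apply, pairE_apply]
        generalize (if i = 0 then (1 : ZMod 2) else 0) = x
        generalize (if i = j then (1 : ZMod 2) else 0) = y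
        generalize (if i = k then (1 : ZMod 2) else 0) = z
        revert x y z; decide
      rw [this, qt_pairE hjk])
    (by
      intro j k hj hk hjk h
      have e : pairE (p j) (r j) = pairE (p k) (r k) := by
        rcases h with ⟨h1, h2⟩ | ⟨h1, h2⟩
        · rw [h1, h2]
        · rw [h1, h2, mk_pairE_swap]
      have e2 := (hp j hj).2
      rw [e, ← (hp k hk).2] at e2
      have := pair_inj (Ne.symm hj) (Ne.symm hk) (f.injective e2)
      grind)
  have hs : ∀ j : Fin 8, ∃ s, (j = 0 → s = c) ∧ (j ≠ 0 → c ≠ s ∧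
      f (Submodule.Quotient.mk (pairE 0 j)) = Submodule.Quotient.mk (pairE c s)) := by
    intro j
    by_cases hj : j = 0
    · exact ⟨c, fun _ => rfl, fun h => absurd hj h⟩
    · obtain ⟨h1, h2⟩ := hp j hj
      rcases hc j hj with h | h
      · exact ⟨r j, fun h => absurd h hj, fun _ => ⟨h ▸ h1, by rw [h2, h]⟩⟩
      · exact ⟨p j, fun h => absurd h hj, fun _ => ⟨h ▸ h1.symm, by rw [h2, h, mk_pairE_swap]⟩⟩
  choose s hs0 hs using hs
  have hinj : Function.Injective s := by
    intro j k hjk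
    by_cases hj : j = 0 <;> by_cases hk : k = 0
    · rw [hj, hk]
    · exact absurd ((hs0 j hj).symm.trans hjk) (hs k hk).1
    · exact absurd ((hs0 k hk).symm.trans hjk.symm) (hs j hj).1
    · have e2 := (hs j hj).2
      rw [hjk, ← (hs k hk).2] at e2
      have := pair_inj (Ne.symm hj) (Ne.symm hk) (f.injective e2)
      grind
  let σ : Equiv.Perm (Fin 8) := Equiv.ofBijective s (Finite.injective_iff_bijective.1 hinj)
  refine ⟨σ, ?_⟩
  have hgen : ∀ j, PhiW σ (Submodule.Quotient.mk (pairE 0 j)) =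
      f (Submodule.Quotient.mk (pairE 0 j)) := by
    intro j
    by_cases hj : j = 0
    · have : pairE 0 j = 0 := by
        subst hj
        apply Subtype.ext
        funext i
        rw [pairE_apply]
        show _ = (0 : ZMod 2)
        split_ifs <;> decide
      rw [this, Submodule.Quotient.mk_zero, map_zero, map_zero]
    · rw [PhiW_mk, permE_pairE, (hs j hj).2]
      show Submodule.Quotient.mk (pairE (s 0) (s j)) = _
      rw [hs0 0 rfl]
  ext w
  obtain ⟨v, rfl⟩ := Submodule.Quotient.mk_surjective _ w
  have hv : (Submodule.Quotient.mk v : Esub ⧸ Jsub) =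
      ∑ j, (v : Fin 8 → ZMod 2) j • Submodule.Quotient.mk (pairE 0 j) := by
    conv_lhs => rw [sum_pairE v]
    exact map_sum Jsub.mkQ _ _
  rw [hv, map_sum, map_sum]
  refine Finset.sum_congr rfl fun j _ => ?_
  rw [map_smul, map_smul, hgen]

/-- (i) `q̃(v + 𝟙) = q̃(v)`, so `q̃` descends to `q : W → F₂` on
`W = E/J`; (ii) every permutation `σ` of the 8 coordinates preserves `J` and `q̃`,
inducing an `F₂`-linear automorphism `Φ σ` of `W` with `q ∘ Φ σ = q`; (iii) the
resulting homomorphism `Φ : S₈ → O(W, q)` is bijective, so `O(W, q) ≅ S₈`. -/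
theorem stmt15 :
    (∀ v : Esub, qt (v + oneE) = qt v) ∧
    ∃ q : (Esub ⧸ Jsub) → ZMod 2,
      (∀ v : Esub, q (Submodule.Quotient.mk v) = qt v) ∧
      (∀ σ : Equiv.Perm (Fin 8), Submodule.map (permE σ) Jsub = Jsub) ∧
      (∀ (σ : Equiv.Perm (Fin 8)) (v : Esub), qt (permE σ v) = qt v) ∧
      ∃ Φ : Equiv.Perm (Fin 8) →* ((Esub ⧸ Jsub) ≃ₗ[ZMod 2] (Esub ⧸ Jsub)),
        (∀ (σ : Equiv.Perm (Fin 8)) (v : Esub),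
          Φ σ (Submodule.Quotient.mk v) = Submodule.Quotient.mk (permE σ v)) ∧
        (∀ (σ : Equiv.Perm (Fin 8)) (w : Esub ⧸ Jsub), q (Φ σ w) = q w) ∧
        Function.Injective Φ ∧
        (∀ f : (Esub ⧸ Jsub) ≃ₗ[ZMod 2] (Esub ⧸ Jsub),
          (∀ w : Esub ⧸ Jsub, q (f w) = q w) → ∃ σ : Equiv.Perm (Fin 8), Φ σ = f) := by
  refine ⟨qt_add_one, qW, qW_mk, map_permE, qt_permE, PhiW, PhiW_mk, ?_, PhiW_injective, PhiW_surj⟩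
  intro σ w
  obtain ⟨v, rfl⟩ := Submodule.Quotient.mk_surjective _ w
  rw [PhiW_mk, qW_mk, qW_mk, qt_permE]
end

section
/- Let F₂ = ℤ/2ℤ, E := {v : Fin 8 → F₂ | Σᵢ v(i) = 0}, 𝟙 ∈ E the all-ones vector, and W := E/F₂·𝟙. Let σ be a permutation of Fin 8 with σ∘σ = id whose set of non-fixed points has cardinality 2k (0 ≤ k ≤ 4), acting on W by permuting coordinates. Then the number of elements w ∈ W with σ·w = w equals 2^(6−k) if k ≤ 3, and equals 16 if k = 4. Equivalently, the fixed subspace of σ acting on the 6-dimensional F₂-vector space W has dimension 6−k for k = 0, 1, 2, 3 and dimension 4 for k = 4. -/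
/-- The induced action of a permutation `σ` of the 8 coordinates on `W = E/J`. -/
def permW (σ : Equiv.Perm (Fin 8)) : (Esub ⧸ Jsub) →ₗ[ZMod 2] (Esub ⧸ Jsub) :=
  Submodule.mapQ Jsub Jsub (permE σ) (by
    rw [Jsub, Submodule.span_le]
    intro x hx
    rw [Set.mem_singleton_iff] at hx
    subst hx
    rw [SetLike.mem_coe, Submodule.mem_comap]
    have h : permE σ oneE = oneE := Subtype.ext rfl
    rw [h]
    exact Submodule.mem_span_singleton_self _)

/-- Vectors of even weight which are fixed by `σ` up to adding the all-ones vector. -/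
def goodVec (σ : Equiv.Perm (Fin 8)) (v : Fin 8 → ZMod 2) : Prop :=
  ∑ i, v i = 0 ∧ ((∀ i, v (σ i) = v i) ∨ (∀ i, v (σ i) = v i + 1))

instance (σ : Equiv.Perm (Fin 8)) : DecidablePred (goodVec σ) :=
  fun v => by unfold goodVec; infer_instance

/-- Number of good vectors. -/
def goodCount (σ : Equiv.Perm (Fin 8)) : ℕ :=
  Fintype.card {v : Fin 8 → ZMod 2 // goodVec σ v}

theorem goodVec_conj (σ c : Equiv.Perm (Fin 8)) (v : Fin 8 → ZMod 2) :
    goodVec σ (v ∘ c) ↔ goodVec (c * σ * c⁻¹) v := by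
  unfold goodVec
  have h1 : ∑ i, (v ∘ c) i = ∑ i, v i := Equiv.sum_comp c v
  rw [h1]
  refine and_congr Iff.rfl (or_congr ?_ ?_)
  · refine ⟨fun h i => ?_, fun h i => ?_⟩
    · simpa using h (c⁻¹ i)
    · simpa using h (c i)
  · refine ⟨fun h i => ?_, fun h i => ?_⟩
    · simpa using h (c⁻¹ i)
    · simpa using h (c i)

theorem goodCount_conj {σ τ : Equiv.Perm (Fin 8)} (h : IsConj σ τ) :
    goodCount σ = goodCount τ := by
  obtain ⟨c, rfl⟩ := isConj_iff.1 h
  refine Fintype.card_congr (Equiv.subtypeEquiv (Equiv.arrowCongr c (Equiv.refl _)) ?_)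
  intro v
  rw [← goodVec_conj]
  have : (Equiv.arrowCongr c (Equiv.refl (ZMod 2))) v ∘ c = v := by
    funext i; simp
  rw [this]

theorem cycleType_invol (σ : Equiv.Perm (Fin 8)) (k : ℕ)
    (hinv : ∀ x : Fin 8, σ (σ x) = x)
    (hk : (Finset.univ.filter fun x : Fin 8 => σ x ≠ x).card = 2 * k) :
    σ.cycleType = Multiset.replicate k 2 := by
  have h2 : σ ^ 2 = 1 := by
    ext x; simp [pow_two, hinv]
  have h3 := Equiv.Perm.pow_prime_eq_one_iff.1 h2
  have h4 := Multiset.eq_replicate_card.2 h3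
  have h5 := σ.sum_cycleType
  have h6 : σ.support.card = 2 * k := hk
  rw [h4, h6, Multiset.sum_replicate, smul_eq_mul] at h5
  rw [h4]
  congr 1
  omega

/-- Representatives of the classes of involutions. -/
def repPerm : ℕ → Equiv.Perm (Fin 8)
  | 0 => 1
  | 1 => Equiv.swap 0 1
  | 2 => Equiv.swap 0 1 * Equiv.swap 2 3
  | 3 => Equiv.swap 0 1 * Equiv.swap 2 3 * Equiv.swap 4 5
  | _ => Equiv.swap 0 1 * Equiv.swap 2 3 * Equiv.swap 4 5 * Equiv.swap 6 7

theorem goodCount_rep (k : Fin 5) :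
    goodCount (repPerm k) = if (k : ℕ) = 4 then 32 else 2 ^ (7 - (k : ℕ)) := by
  revert k
  decide +kernel

theorem goodCount_eq (σ : Equiv.Perm (Fin 8)) (k : ℕ) (hk4 : k ≤ 4)
    (hinv : ∀ x : Fin 8, σ (σ x) = x)
    (hk : (Finset.univ.filter fun x : Fin 8 => σ x ≠ x).card = 2 * k) :
    goodCount σ = if k = 4 then 32 else 2 ^ (7 - k) := by
  have hr : ∀ k : Fin 5, (∀ x : Fin 8, repPerm k (repPerm k x) = x) ∧
      (Finset.univ.filter fun x : Fin 8 => repPerm k x ≠ x).card = 2 * (k : ℕ) := by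
    decide +kernel
  obtain ⟨ha, hb⟩ := hr ⟨k, by omega⟩
  have hc : IsConj σ (repPerm k) := by
    rw [Equiv.Perm.isConj_iff_cycleType_eq, cycleType_invol σ k hinv hk,
      cycleType_invol _ k ha hb]
  rw [goodCount_conj hc]
  exact goodCount_rep ⟨k, by omega⟩

theorem mem_Jsub (e : Esub) : e ∈ Jsub ↔ e = 0 ∨ e = oneE := by
  unfold Jsub
  rw [Submodule.mem_span_singleton]
  constructor
  · rintro ⟨c, rfl⟩
    have : c = 0 ∨ c = 1 := by revert c; decide
    rcases this with rfl | rfl <;> simp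
  · rintro (rfl | rfl)
    · exact ⟨0, by simp⟩
    · exact ⟨1, by simp⟩

theorem card_Jsub : Nat.card Jsub = 2 := by
  have h : (Jsub : Set Esub) = {0, oneE} := by
    ext e; simp [mem_Jsub]
  have h0 : (0 : Esub) ≠ oneE := by
    intro h
    have := congrArg (fun e : Esub => (e : Fin 8 → ZMod 2) 0) h
    exact absurd this (by decide)
  have : (Jsub : Set Esub).ncard = 2 := by rw [h, Set.ncard_pair h0]
  exact this

theorem fixed_iff (σ : Equiv.Perm (Fin 8)) (hinv : ∀ x : Fin 8, σ (σ x) = x) (e : Esub) :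
    permW σ (Submodule.Quotient.mk e) = Submodule.Quotient.mk e ↔
      goodVec σ (e : Fin 8 → ZMod 2) := by
  have hs : ∀ x, σ.symm x = σ x := fun x => by rw [Equiv.symm_apply_eq, hinv]
  have h1 : permW σ (Submodule.Quotient.mk e) = Submodule.Quotient.mk (permE σ e) := rfl
  have hsum : ∑ i, (e : Fin 8 → ZMod 2) i = 0 := e.2
  rw [h1, Submodule.Quotient.eq, mem_Jsub, sub_eq_zero, sub_eq_iff_eq_add]
  unfold goodVec
  simp only [hsum, true_and, Subtype.ext_iff, funext_iff]
  refine or_congr (forall_congr' fun i => ?_) (forall_congr' fun i => ?_)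
  · change (e : Fin 8 → ZMod 2) (σ.symm i) = _ ↔ _
    rw [hs]
  · change (e : Fin 8 → ZMod 2) (σ.symm i) = 1 + (e : Fin 8 → ZMod 2) i ↔ _
    rw [hs, add_comm]

theorem two_mul_ncard (σ : Equiv.Perm (Fin 8)) (hinv : ∀ x : Fin 8, σ (σ x) = x) :
    2 * {w : Esub ⧸ Jsub | permW σ w = w}.ncard = goodCount σ := by
  have e1 := QuotientAddGroup.preimageMkEquivAddSubgroupProdSet Jsub.toAddSubgroup
    {w : Esub ⧸ Jsub | permW σ w = w}
  have h1 := Nat.card_congr e1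
  rw [Nat.card_prod] at h1
  have h2 : Nat.card Jsub.toAddSubgroup = 2 := card_Jsub
  rw [h2] at h1
  refine h1.symm.trans ?_
  unfold goodCount
  rw [← Nat.card_eq_fintype_card]
  refine Nat.card_congr ⟨fun x => ⟨x.1.1, (fixed_iff σ hinv x.1).1 x.2⟩,
    fun v => ⟨⟨v.1, v.2.1⟩, (fixed_iff σ hinv ⟨v.1, v.2.1⟩).2 v.2⟩, fun x => rfl, fun v => rfl⟩

/-- Let `σ` be an involutive permutation of the 8 coordinates with
`2k` non-fixed points, acting on `W = E/J`.  Then the number of `w ∈ W` fixed by `σ`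
is `2^(6−k)` for `k ≤ 3`, and `16` for `k = 4`; equivalently, the fixed subspace has
dimension `6 − k` for `k = 0, 1, 2, 3` and dimension `4` for `k = 4`. -/
theorem stmt17 (σ : Equiv.Perm (Fin 8)) (k : ℕ)
    (hinv : ∀ x : Fin 8, σ (σ x) = x)
    (hk : (Finset.univ.filter fun x : Fin 8 => σ x ≠ x).card = 2 * k) :
    (k ≤ 3 → {w : Esub ⧸ Jsub | permW σ w = w}.ncard = 2 ^ (6 - k)) ∧
    (k = 4 → {w : Esub ⧸ Jsub | permW σ w = w}.ncard = 16) := by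
  have h := two_mul_ncard σ hinv
  constructor
  · intro h3
    rw [goodCount_eq σ k (by omega) hinv hk, if_neg (by omega),
      show 7 - k = (6 - k) + 1 by omega, pow_succ] at h
    omega
  · intro h4
    rw [goodCount_eq σ k (by omega) hinv hk, if_pos h4] at h
    omega
end

section
/- Fix k ∈ {0, 1, 2, 3}. Let S_k be the set of coefficient vectors a : Fin 9 → ℝ such that, with g_a := Σ_{i=0}^{8} a_i X^i ∈ ℝ[X]: the image of g_a in ℂ[X] is squarefree, the degree of g_a is at least 7, and the number of distinct real roots of g_a plus (1 if deg(g_a) = 7, else 0) equals 8 − 2k. Then S_k is path-connected in the Euclidean topology on Fin 9 → ℝ. -/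
/-- The real polynomial `g_a = Σ_{i=0}^{8} a_i X^i` associated to a coefficient
vector `a : Fin 9 → ℝ` (the dehomogenization of the real binary octic form
`p_a(x₀,x₁) = Σ a_i x₀^i x₁^{8−i}`). -/
noncomputable def polyOf (a : Fin 9 → ℝ) : Polynomial ℝ :=
  ∑ i : Fin 9, Polynomial.C (a i) * Polynomial.X ^ (i : ℕ)

open Polynomial

/-- Linear factor with projective root at angle `t`. -/
noncomputable def ellF (t : ℝ) : ℝ[X] := C (Real.cos t) * X - C (Real.sin t)

/-- Quadratic factor without real roots. -/
noncomputable def quadF (z : ℂ) : ℝ[X] := (X - C z.re) ^ 2 + C (Real.exp z.im)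

/-- The full product. -/
noncomputable def bigF {n k : ℕ} (w : ℝ × ((Fin (n + 1) → ℝ) × (Fin k → ℂ))) : ℝ[X] :=
  C w.1 * ((∏ i, ellF (w.2.1 i)) * ∏ j, quadF (w.2.2 j))

def angSet (n : ℕ) : Set (Fin (n + 1) → ℝ) :=
  {t | StrictMono t ∧ t (Fin.last n) < t 0 + Real.pi}

def confSet (k : ℕ) : Set (Fin k → ℂ) := {z | Function.Injective z}

def parSet (n k : ℕ) : Set (ℝ × ((Fin (n + 1) → ℝ) × (Fin k → ℂ))) :=
  Set.Ioi 0 ×ˢ (angSet n ×ˢ confSet k)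

lemma angSet_pc (n : ℕ) : IsPathConnected (angSet n) := by
  apply Convex.isPathConnected
  · rintro x ⟨hx, hx'⟩ y ⟨hy, hy'⟩ a b ha hb hab
    refine ⟨fun i j hij => ?_, ?_⟩
    · have h1 := hx hij
      have h2 := hy hij
      simp only [Pi.add_apply, Pi.smul_apply, smul_eq_mul]
      rcases ha.eq_or_lt with rfl | ha
      · have : b = 1 := by linarith
        subst this; linarith
      · nlinarith [mul_lt_mul_of_pos_left h1 ha, mul_le_mul_of_nonneg_left h2.le hb]
    · simp only [Pi.add_apply, Pi.smul_apply, smul_eq_mul]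
      have : Real.pi = a * Real.pi + b * Real.pi := by rw [← add_mul, hab, one_mul]
      rw [this]
      rcases ha.eq_or_lt with rfl | ha
      · have : b = 1 := by linarith
        subst this; linarith
      · nlinarith [mul_lt_mul_of_pos_left hx' ha, mul_le_mul_of_nonneg_left hy'.le hb]
  · refine ⟨fun i => (i : ℕ) / ((n : ℝ) + 1), fun i j hij => ?_, ?_⟩
    · have : ((i : ℕ) : ℝ) < (j : ℕ) := by exact_mod_cast hij
      have hn : (0 : ℝ) < n + 1 := by positivity
      exact div_lt_div_of_pos_right this hn
    · have hn : (0 : ℝ) < n + 1 := by positivity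
      simp only [Fin.val_last, Fin.val_zero, Nat.cast_zero, zero_div, zero_add]
      have : (n : ℝ) / (n + 1) < 1 := by rw [div_lt_one hn]; linarith
      linarith [Real.pi_gt_three]

lemma confSet_pc (k : ℕ) : IsPathConnected (confSet k) := by
  rw [isPathConnected_iff]
  refine ⟨⟨fun j => ((j : ℕ) : ℂ), fun i j h => ?_⟩, fun z hz w hw => ?_⟩
  · have h' : ((i : ℕ) : ℂ) = ((j : ℕ) : ℂ) := h
    exact Fin.ext (by exact_mod_cast h')
  · let f : ℂ → (Fin k → ℂ) := fun t j => (1 - t) * z j + t * w j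
    have hf : Continuous f := by fun_prop
    let bad : Set ℂ := ⋃ i : Fin k, ⋃ j : Fin k, {t | i ≠ j ∧ f t i = f t j}
    have hbad : bad.Countable := by
      refine Set.countable_iUnion fun i => Set.countable_iUnion fun j => ?_
      apply Set.Subsingleton.countable
      rintro s ⟨hij, hs⟩ t ⟨-, ht⟩
      simp only [f] at hs ht
      have hzz : z i - z j ≠ 0 := sub_ne_zero.2 fun h => hij (hz h)
      have h3 : (t - s) * (z i - z j) = 0 := by linear_combination t * hs - s * ht
      rcases mul_eq_zero.1 h3 with h | h
      · exact (sub_eq_zero.1 h).symm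
      · exact absurd h hzz
    have hpc := hbad.isPathConnected_compl_of_one_lt_rank (E := ℂ)
      (by rw [Complex.rank_real_complex]; norm_num)
    have himg := hpc.image hf
    have hsub : f '' badᶜ ⊆ confSet k := by
      rintro _ ⟨t, ht, rfl⟩ i j hij
      by_contra hne
      exact ht (Set.mem_iUnion.2 ⟨i, Set.mem_iUnion.2 ⟨j, hne, hij⟩⟩)
    have h0 : z ∈ f '' badᶜ := by
      refine ⟨0, ?_, by ext j; simp [f]⟩
      simp only [bad, Set.mem_compl_iff, Set.mem_iUnion, not_exists]
      rintro i j ⟨hij, h⟩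
      simp only [f] at h
      exact hij (hz (by simpa using h))
    have h1 : w ∈ f '' badᶜ := by
      refine ⟨1, ?_, by ext j; simp [f]⟩
      simp only [bad, Set.mem_compl_iff, Set.mem_iUnion, not_exists]
      rintro i j ⟨hij, h⟩
      simp only [f] at h
      exact hij (hw (by simpa using h))
    exact (himg.joinedIn _ h0 _ h1).mono hsub

lemma parSet_pc (n k : ℕ) : IsPathConnected (parSet n k) :=
  ((convex_Ioi (0 : ℝ)).isPathConnected ⟨1, by simp⟩).prod ((angSet_pc n).prod (confSet_pc k))

/-- coefficientwise continuity -/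
def CC {Y : Type*} [TopologicalSpace Y] (P : Y → ℝ[X]) : Prop :=
  ∀ i, Continuous fun y => (P y).coeff i

lemma CC.mul {Y : Type*} [TopologicalSpace Y] {P Q : Y → ℝ[X]} (hP : CC P) (hQ : CC Q) :
    CC fun y => P y * Q y := by
  intro i
  simp only [coeff_mul]
  exact continuous_finsetSum _ fun x _ => (hP _).mul (hQ _)

lemma CC.add {Y : Type*} [TopologicalSpace Y] {P Q : Y → ℝ[X]} (hP : CC P) (hQ : CC Q) :
    CC fun y => P y + Q y := by
  intro i
  simp only [coeff_add]
  exact (hP _).add (hQ _)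

lemma CC.sub {Y : Type*} [TopologicalSpace Y] {P Q : Y → ℝ[X]} (hP : CC P) (hQ : CC Q) :
    CC fun y => P y - Q y := by
  intro i
  simp only [coeff_sub]
  exact (hP _).sub (hQ _)

lemma CC.const {Y : Type*} [TopologicalSpace Y] (p : ℝ[X]) : CC fun _ : Y => p :=
  fun _ => continuous_const

lemma CC.C {Y : Type*} [TopologicalSpace Y] {f : Y → ℝ} (hf : Continuous f) :
    CC fun y => Polynomial.C (f y) := by
  intro i
  simp only [coeff_C]
  split_ifs
  · exact hf
  · exact continuous_const

lemma CC.prod {Y ι : Type*} [TopologicalSpace Y] (s : Finset ι) {P : ι → Y → ℝ[X]}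
    (hP : ∀ i, CC (P i)) : CC fun y => ∏ i ∈ s, P i y := by
  classical
  induction s using Finset.induction_on with
  | empty => simpa using CC.const 1
  | insert a s ha ih =>
    simp only [Finset.prod_insert ha]
    exact (hP a).mul ih

lemma bigF_cc {n k : ℕ} : CC (bigF (n := n) (k := k)) := by
  unfold bigF ellF quadF
  refine (CC.C continuous_fst).mul ((CC.prod _ fun i => ?_).mul (CC.prod _ fun j => ?_))
  · exact ((CC.C (by fun_prop)).mul (CC.const X)).sub (CC.C (by fun_prop))
  · simp only [pow_two]
    have h : CC fun w : ℝ × ((Fin (n + 1) → ℝ) × (Fin k → ℂ)) => X - Polynomial.C (w.2.2 j).re :=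
      (CC.const X).sub (CC.C (by fun_prop))
    exact (h.mul h).add (CC.C (by fun_prop))

/-! Membership -/

lemma quadF_monic (z : ℂ) : (quadF z).Monic := by
  unfold quadF; monicity!

lemma quadF_natDegree (z : ℂ) : (quadF z).natDegree = 2 := by
  unfold quadF; compute_degree!

lemma quadF_roots (z : ℂ) : (quadF z).roots = 0 := by
  apply Multiset.eq_zero_of_forall_notMem
  intro x hx
  have := (mem_roots'.1 hx).2
  simp [quadF] at this
  nlinarith [sq_nonneg (x - z.re), Real.exp_pos z.im]

lemma quadF_irr (z : ℂ) : Irreducible (quadF z) := by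
  rw [(quadF_monic z).irreducible_iff_roots_eq_zero_of_degree_le_three
    (quadF_natDegree z).ge (by rw [quadF_natDegree]; norm_num)]
  exact quadF_roots z

lemma quadF_inj {z w : ℂ} (h : quadF z = quadF w) : z = w := by
  have h0 := congrArg (Polynomial.eval 0) h
  have h1 := congrArg (Polynomial.eval 1) h
  simp [quadF] at h0 h1
  have hre : z.re = w.re := by linarith
  have him : Real.exp z.im = Real.exp w.im := by rw [hre] at h0; linarith
  exact Complex.ext hre (Real.exp_injective him)

lemma ellF_ne_zero (t : ℝ) : ellF t ≠ 0 := by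
  intro h
  have h0 := congrArg (fun p => coeff p 0) h
  have h1 := congrArg (fun p => coeff p 1) h
  simp [ellF, coeff_C] at h0 h1
  have := Real.sin_sq_add_cos_sq t
  rw [h0, h1] at this
  norm_num at this

lemma ellF_eq_of_cos {t : ℝ} (h : Real.cos t = 0) : ellF t = C (-Real.sin t) := by
  unfold ellF; rw [h]; simp

lemma ellF_natDegree (t : ℝ) : (ellF t).natDegree = if Real.cos t = 0 then 0 else 1 := by
  split_ifs with h
  · rw [ellF_eq_of_cos h, natDegree_C]
  · unfold ellF; rw [sub_eq_add_neg, ← C_neg, natDegree_linear h]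

lemma ellF_roots_card (t : ℝ) : (ellF t).roots.card = if Real.cos t = 0 then 0 else 1 := by
  split_ifs with h
  · rw [ellF_eq_of_cos h, roots_C]; rfl
  · unfold ellF; rw [roots_C_mul_X_sub_C _ h]; rfl

lemma ellF_sep (t : ℝ) : (ellF t).Separable := by
  refine ⟨-C (Real.sin t), C (Real.cos t) + C (Real.sin t) * X, ?_⟩
  have h : (C (Real.sin t) : ℝ[X]) ^ 2 + C (Real.cos t) ^ 2 = 1 := by
    rw [← C_pow, ← C_pow, ← C_add, Real.sin_sq_add_cos_sq, C_1]
  simp only [ellF, derivative_sub, derivative_mul, derivative_C, derivative_X]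
  linear_combination h

lemma ellF_coprime {s t : ℝ} (h : Real.sin (t - s) ≠ 0) : IsCoprime (ellF s) (ellF t) := by
  refine ⟨C ((Real.sin (t - s))⁻¹) * C (Real.cos t), -C ((Real.sin (t - s))⁻¹) * C (Real.cos s), ?_⟩
  have h1 : (C ((Real.sin (t - s))⁻¹) : ℝ[X]) * C (Real.sin (t - s)) = 1 := by
    rw [← C_mul, inv_mul_cancel₀ h, C_1]
  have h2 : (C (Real.sin (t - s)) : ℝ[X]) =
      C (Real.sin t) * C (Real.cos s) - C (Real.cos t) * C (Real.sin s) := by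
    rw [Real.sin_sub]; simp
  rw [h2] at h1
  simp only [ellF]
  linear_combination h1

lemma ellF_quadF (t : ℝ) (z : ℂ) : IsCoprime (ellF t) (quadF z) := by
  rcases (quadF_irr z).isCoprime_or_dvd (ellF t) with h | h
  · exact h.symm
  · have := natDegree_le_of_dvd h (ellF_ne_zero t)
    rw [quadF_natDegree, ellF_natDegree] at this
    split_ifs at this <;> omega

lemma quadF_coprime {z w : ℂ} (h : z ≠ w) : IsCoprime (quadF z) (quadF w) := by
  rcases (quadF_irr z).isCoprime_or_dvd (quadF w) with h1 | h1
  · exact h1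
  · refine absurd (quadF_inj ?_) h.symm
    exact eq_of_monic_of_dvd_of_natDegree_le (quadF_monic z) (quadF_monic w) h1
      (by rw [quadF_natDegree, quadF_natDegree])

lemma angSet_sin {n : ℕ} {t : Fin (n + 1) → ℝ} (ht : t ∈ angSet n) {i j : Fin (n + 1)}
    (hij : i ≠ j) : Real.sin (t j - t i) ≠ 0 := by
  have key : ∀ i j : Fin (n + 1), i < j → 0 < Real.sin (t j - t i) := by
    intro i j hij
    have h1 := ht.1 hij
    have h2 := ht.1.monotone (Fin.zero_le i)
    have h3 := ht.1.monotone (Fin.le_last j)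
    have h4 := ht.2
    exact Real.sin_pos_of_pos_of_lt_pi (by linarith) (by linarith)
  rcases lt_or_gt_of_ne hij with h | h
  · exact (key i j h).ne'
  · have := key j i h
    rw [← neg_sub, Real.sin_neg] at this
    intro h0
    rw [h0] at this
    simp at this

lemma bigF_sep {n k : ℕ} {w : ℝ × ((Fin (n + 1) → ℝ) × (Fin k → ℂ))} (hw : w ∈ parSet n k) :
    (bigF w).Separable := by
  obtain ⟨hc, ht, hz⟩ := hw
  unfold bigF
  apply Separable.unit_mul
  · exact isUnit_C.2 (isUnit_iff_ne_zero.2 (ne_of_gt hc))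
  · apply Separable.mul
    · exact separable_prod (fun i j hij => ellF_coprime (angSet_sin ht hij)) fun i => ellF_sep _
    · exact separable_prod (fun i j hij => quadF_coprime fun h => hij (hz h))
        fun i => (quadF_irr _).separable
    · exact IsCoprime.prod_left fun i _ => IsCoprime.prod_right fun j _ => ellF_quadF _ _

/-- number of finite real roots -/
noncomputable def numF {n : ℕ} (t : Fin (n + 1) → ℝ) : ℕ := ∑ i, if Real.cos (t i) = 0 then 0 else 1

lemma numF_bounds {n : ℕ} {t : Fin (n + 1) → ℝ} (ht : t ∈ angSet n) :
    n ≤ numF t ∧ numF t ≤ n + 1 := by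
  have h1 : numF t + (Finset.univ.filter fun i => Real.cos (t i) = 0).card = n + 1 := by
    rw [numF, Finset.card_filter, ← Finset.sum_add_distrib]
    have : ∀ i : Fin (n + 1), ((if Real.cos (t i) = 0 then 0 else 1) +
        if Real.cos (t i) = 0 then 1 else 0) = 1 := by
      intro i; split_ifs <;> rfl
    simp [this]
  have h2 : (Finset.univ.filter fun i => Real.cos (t i) = 0).card ≤ 1 := by
    rw [Finset.card_le_one]
    intro i hi j hj
    simp only [Finset.mem_filter, Finset.mem_univ, true_and] at hi hj
    by_contra hij
    apply angSet_sin ht hij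
    rw [Real.sin_sub, hi, hj]; simp
  omega

lemma bigF_natDegree {n k : ℕ} {w : ℝ × ((Fin (n + 1) → ℝ) × (Fin k → ℂ))} (hw : w ∈ parSet n k) :
    (bigF w).natDegree = numF w.2.1 + 2 * k := by
  obtain ⟨hc, ht, hz⟩ := hw
  have he : ∏ i, ellF (w.2.1 i) ≠ 0 := Finset.prod_ne_zero_iff.2 fun i _ => ellF_ne_zero _
  have hq : ∏ j, quadF (w.2.2 j) ≠ 0 := Finset.prod_ne_zero_iff.2 fun j _ => (quadF_irr _).ne_zero
  unfold bigF
  rw [natDegree_C_mul (ne_of_gt hc), natDegree_mul he hq,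
    natDegree_prod _ _ (fun i _ => ellF_ne_zero _),
    natDegree_prod _ _ (fun i _ => (quadF_irr _).ne_zero)]
  simp [ellF_natDegree, quadF_natDegree, numF, mul_comm]

lemma bigF_roots {n k : ℕ} {w : ℝ × ((Fin (n + 1) → ℝ) × (Fin k → ℂ))} (hw : w ∈ parSet n k) :
    (bigF w).roots.toFinset.card = numF w.2.1 := by
  rw [Multiset.toFinset_card_of_nodup (nodup_roots (bigF_sep hw))]
  obtain ⟨hc, ht, hz⟩ := hw
  have he : ∏ i, ellF (w.2.1 i) ≠ 0 := Finset.prod_ne_zero_iff.2 fun i _ => ellF_ne_zero _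
  have hq : ∏ j, quadF (w.2.2 j) ≠ 0 := Finset.prod_ne_zero_iff.2 fun j _ => (quadF_irr _).ne_zero
  unfold bigF
  rw [roots_C_mul _ (ne_of_gt hc), roots_mul (mul_ne_zero he hq), roots_prod _ _ he,
    roots_prod _ _ hq]
  simp [quadF_roots, Multiset.card_bind, ellF_roots_card, numF, Finset.sum]

lemma polyOf_coeff (a : Fin 9 → ℝ) (i : Fin 9) : (polyOf a).coeff i = a i := by
  simp only [polyOf, finsetSum_coeff, coeff_C_mul, coeff_X_pow]
  rw [Finset.sum_eq_single i]
  · simp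
  · intro j _ hj
    rw [if_neg (fun h => hj (Fin.ext h.symm)), mul_zero]
  · simp

lemma polyOf_natDegree_le (a : Fin 9 → ℝ) : (polyOf a).natDegree ≤ 8 := by
  unfold polyOf
  apply natDegree_sum_le_of_forall_le
  intro i _
  exact (natDegree_C_mul_X_pow_le _ _).trans (by omega)

lemma polyOf_of_coeff {p : ℝ[X]} (hp : p.natDegree ≤ 8) :
    polyOf (fun i : Fin 9 => p.coeff i) = p := by
  ext m
  by_cases hm : m < 9
  · exact polyOf_coeff _ ⟨m, hm⟩
  · rw [coeff_eq_zero_of_natDegree_lt (lt_of_le_of_lt (polyOf_natDegree_le _) (by omega)),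
      coeff_eq_zero_of_natDegree_lt (lt_of_le_of_lt hp (by omega))]

/-! Surjectivity -/

lemma quad_factor (k : ℕ) : ∀ h : ℝ[X], h.Monic → h.roots = 0 → h.natDegree = 2 * k →
    ∃ z : Fin k → ℂ, h = ∏ j, quadF (z j) := by
  induction k with
  | zero =>
    intro h hm _ hd
    exact ⟨fun _ => 0, by simpa using hm.natDegree_eq_zero.1 hd⟩
  | succ k ih =>
    intro h hm hr hd
    obtain ⟨z, hz⟩ : ∃ z : ℂ, aeval z h = 0 :=
      IsAlgClosed.exists_aeval_eq_zero _ h (by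
        rw [degree_eq_natDegree hm.ne_zero, hd]; exact_mod_cast (by omega : 2 * (k + 1) ≠ 0))
    have him : z.im ≠ 0 := by
      intro h0
      have hz' : z = algebraMap ℝ ℂ z.re := Complex.ext (by simp) (by simp [h0])
      rw [hz', aeval_algebraMap_apply] at hz
      have : eval z.re h = 0 := by simpa using hz
      have hmem : z.re ∈ h.roots := (mem_roots hm.ne_zero).2 this
      rw [hr] at hmem
      simp at hmem
    have hdvd := h.quadratic_dvd_of_aeval_eq_zero_im_ne_zero hz him
    have heq : X ^ 2 - C (2 * z.re) * X + C (‖z‖ ^ 2) = quadF ⟨z.re, Real.log (z.im ^ 2)⟩ := by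
      have h1 : ‖z‖ ^ 2 = z.re ^ 2 + z.im ^ 2 := by
        rw [Complex.sq_norm, Complex.normSq_apply]; ring
      simp only [quadF]
      rw [Real.exp_log (by positivity), h1]
      simp only [C_add, C_mul, C_pow, C_ofNat]
      ring
    rw [heq] at hdvd
    obtain ⟨q, hq⟩ := hdvd
    have hqm : q.Monic := (quadF_monic _).of_mul_monic_left (hq ▸ hm)
    have hdeg := (quadF_monic ⟨z.re, Real.log (z.im ^ 2)⟩).natDegree_mul hqm
    rw [← hq, hd, quadF_natDegree] at hdeg
    have hroots : q.roots = 0 := by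
      have := roots_mul (hq ▸ hm.ne_zero : quadF ⟨z.re, Real.log (z.im ^ 2)⟩ * q ≠ 0)
      rw [← hq, hr, quadF_roots, zero_add] at this
      exact this.symm
    obtain ⟨w, hw⟩ := ih q hqm hroots (by omega)
    refine ⟨Fin.cons ⟨z.re, Real.log (z.im ^ 2)⟩ w, ?_⟩
    rw [Fin.prod_univ_succ, hq, hw]
    simp

lemma ellF_arctan (r : ℝ) : ellF (Real.arctan r) = C (Real.cos (Real.arctan r)) * (X - C r) := by
  have h := (Real.cos_arctan_pos r).ne'
  have h2 : Real.sin (Real.arctan r) = Real.cos (Real.arctan r) * r := by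
    have := Real.tan_mul_cos h
    rw [Real.tan_arctan] at this
    rw [← this, mul_comm]
  unfold ellF
  rw [h2, C_mul]; ring

lemma ellF_add_pi (t : ℝ) : ellF (t + Real.pi) = - ellF t := by
  unfold ellF
  rw [Real.cos_add_pi, Real.sin_add_pi, C_neg, C_neg]; ring

lemma ellF_pi_div_two : ellF (Real.pi / 2) = C (-1) := by
  simp [ellF]

lemma angle_image (R : Finset ℝ) : ∃ d : ℝ, d ≠ 0 ∧
    ∏ t ∈ R.image Real.arctan, ellF t = C d * ∏ r ∈ R, (X - C r) := by
  refine ⟨∏ r ∈ R, Real.cos (Real.arctan r),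
    Finset.prod_ne_zero_iff.2 fun r _ => (Real.cos_arctan_pos r).ne', ?_⟩
  rw [Finset.prod_image (fun x _ y _ h => Real.arctan_injective h), map_prod,
    ← Finset.prod_mul_distrib]
  exact Finset.prod_congr rfl fun r _ => ellF_arctan r

lemma angle_finset (R : Finset ℝ) (m e : ℕ) (he : e = 0 ∨ e = 1) (h : R.card + e = m) :
    ∃ T : Finset ℝ, T.card = m ∧ (∀ t ∈ T, -(Real.pi / 2) < t ∧ t ≤ Real.pi / 2) ∧
      ∃ d : ℝ, d ≠ 0 ∧ ∏ t ∈ T, ellF t = C d * ∏ r ∈ R, (X - C r) := by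
  obtain ⟨d, hd, hprod⟩ := angle_image R
  have hcard : (R.image Real.arctan).card = R.card :=
    Finset.card_image_of_injective _ Real.arctan_injective
  rcases he with rfl | rfl
  · refine ⟨R.image Real.arctan, by rw [hcard]; exact h, fun t ht => ?_, d, hd, hprod⟩
    obtain ⟨r, -, rfl⟩ := Finset.mem_image.1 ht
    exact ⟨Real.neg_pi_div_two_lt_arctan r, (Real.arctan_lt_pi_div_two r).le⟩
  · have hnm : Real.pi / 2 ∉ R.image Real.arctan := by
      intro hm
      obtain ⟨r, -, hr⟩ := Finset.mem_image.1 hm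
      exact (Real.arctan_lt_pi_div_two r).ne hr
    refine ⟨insert (Real.pi / 2) (R.image Real.arctan), ?_, fun t ht => ?_, -d, neg_ne_zero.2 hd, ?_⟩
    · rw [Finset.card_insert_of_notMem hnm, hcard, h]
    · rcases Finset.mem_insert.1 ht with rfl | ht
      · exact ⟨by linarith [Real.pi_pos], le_rfl⟩
      · obtain ⟨r, -, rfl⟩ := Finset.mem_image.1 ht
        exact ⟨Real.neg_pi_div_two_lt_arctan r, (Real.arctan_lt_pi_div_two r).le⟩
    · rw [Finset.prod_insert hnm, hprod, ellF_pi_div_two, ← mul_assoc, ← C_mul]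
      simp

lemma angle_vec (n : ℕ) (T : Finset ℝ) (hT : T.card = n + 1)
    (hb : ∀ t ∈ T, -(Real.pi / 2) < t ∧ t ≤ Real.pi / 2) :
    ∃ t ∈ angSet n, ∏ i, ellF (t i) = ∏ s ∈ T, ellF s := by
  refine ⟨T.orderEmbOfFin hT, ⟨(T.orderEmbOfFin hT).strictMono, ?_⟩, ?_⟩
  · have h1 := hb _ (T.orderEmbOfFin_mem hT 0)
    have h2 := hb _ (T.orderEmbOfFin_mem hT (Fin.last n))
    linarith [h1.1, h2.2]
  · rw [← Finset.prod_coe_sort T]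
    exact Fintype.prod_equiv (T.orderIsoOfFin hT).toEquiv _ _ fun i => by simp

lemma angle_shift (n : ℕ) (t : Fin (n + 1) → ℝ) (ht : t ∈ angSet n) :
    ∃ t' ∈ angSet n, ∏ i, ellF (t' i) = - ∏ i, ellF (t i) := by
  refine ⟨Fin.snoc (fun i : Fin n => t i.succ) (t 0 + Real.pi), ⟨?_, ?_⟩, ?_⟩
  · intro i j hij
    induction j using Fin.lastCases with
    | last =>
      induction i using Fin.lastCases with
      | last => exact absurd hij (lt_irrefl _)
      | cast i =>
        simp only [Fin.snoc_castSucc, Fin.snoc_last]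
        exact lt_of_le_of_lt (ht.1.monotone (Fin.le_last _)) ht.2
    | cast j =>
      induction i using Fin.lastCases with
      | last => exact absurd hij (not_lt.2 (Fin.le_last _))
      | cast i =>
        simp only [Fin.snoc_castSucc]
        exact ht.1 (by simpa using hij)
  · rw [Fin.snoc_last]
    have : t 0 < (Fin.snoc (fun i : Fin n => t i.succ) (t 0 + Real.pi) : Fin (n + 1) → ℝ) 0 := by
      rcases n with _ | n
      · have : (0 : Fin 1) = Fin.last 0 := rfl
        rw [this, Fin.snoc_last]
        linarith [Real.pi_pos]
      · have : (0 : Fin (n + 2)) = Fin.castSucc 0 := rfl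
        rw [this, Fin.snoc_castSucc]
        exact ht.1 (by simp)
    linarith
  · rw [Fin.prod_univ_castSucc, Fin.prod_univ_succ (fun i => ellF (t i))]
    simp only [Fin.snoc_castSucc, Fin.snoc_last, ellF_add_pi]
    ring

lemma surj_aux (n k : ℕ) (g : ℝ[X]) (hsep : g.Separable) (e : ℕ) (he : e = 0 ∨ e = 1)
    (hr : g.roots.toFinset.card + e = n + 1)
    (hd : g.natDegree = g.roots.toFinset.card + 2 * k) :
    ∃ w ∈ parSet n k, bigF w = g := by
  have hnd := nodup_roots hsep
  obtain ⟨q, hq, hqd, hqr⟩ := g.exists_prod_multiset_X_sub_C_mul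
  rw [← Multiset.toFinset_card_of_nodup hnd] at hqd
  have hprod : (g.roots.map fun a => X - C a).prod = ∏ r ∈ g.roots.toFinset, (X - C r) := by
    rw [Finset.prod, Multiset.toFinset_val, hnd.dedup]
  rw [hprod] at hq
  have hq0 : q ≠ 0 := by
    rintro rfl
    rw [mul_zero] at hq
    exact hsep.ne_zero hq.symm
  have hl : q.leadingCoeff ≠ 0 := leadingCoeff_ne_zero.2 hq0
  obtain ⟨z, hz⟩ := quad_factor k (q * C q.leadingCoeff⁻¹) (monic_mul_leadingCoeff_inv hq0)
    (by rw [mul_comm, roots_C_mul _ (inv_ne_zero hl), hqr])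
    (by rw [natDegree_mul_leadingCoeff_inv _ hq0]; omega)
  have hqz : q = C q.leadingCoeff * ∏ j, quadF (z j) := by
    rw [← hz, mul_left_comm, ← C_mul, mul_inv_cancel₀ hl, C_1, mul_one]
  have hzinj : z ∈ confSet k := by
    intro i j hij
    by_contra hne
    have h1 : quadF (z i) * quadF (z j) ∣ ∏ j, quadF (z j) := by
      rw [← Finset.prod_pair (f := fun j => quadF (z j)) hne]
      exact Finset.prod_dvd_prod_of_subset _ _ _ (Finset.subset_univ _)
    rw [← hij] at h1
    have h2 : quadF (z i) * quadF (z i) ∣ g := by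
      rw [← hq, hqz]
      exact (h1.mul_left _).mul_left _
    exact (quadF_irr _).not_isUnit (hsep.squarefree _ h2)
  obtain ⟨T, hTc, hTb, d, hd0, hTp⟩ := angle_finset _ _ e he hr
  obtain ⟨t, ht, htp⟩ := angle_vec n T hTc hTb
  have hg : g = C (q.leadingCoeff / d) * ((∏ i, ellF (t i)) * ∏ j, quadF (z j)) := by
    have h1 : (C q.leadingCoeff : ℝ[X]) = C (q.leadingCoeff / d) * C d := by
      rw [← C_mul, div_mul_cancel₀ _ hd0]
    have h2 : g = (∏ r ∈ g.roots.toFinset, (X - C r)) *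
        (C q.leadingCoeff * ∏ j, quadF (z j)) := by
      rw [← hqz]; exact hq.symm
    rw [htp, hTp]
    refine h2.trans ?_
    rw [h1]
    ring
  have hc : q.leadingCoeff / d ≠ 0 := div_ne_zero hl hd0
  rcases lt_or_gt_of_ne hc with hc | hc
  · obtain ⟨t', ht', htp'⟩ := angle_shift n t ht
    refine ⟨(-(q.leadingCoeff / d), (t', z)), ⟨neg_pos.2 hc, ht', hzinj⟩, ?_⟩
    simp only [bigF]
    rw [htp', C_neg]
    conv_rhs => rw [hg]
    ring
  · exact ⟨(q.leadingCoeff / d, (t, z)), ⟨hc, ht, hzinj⟩, hg.symm⟩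

/-- Fix `k ∈ {0, 1, 2, 3}`.  The set `S_k` of coefficient vectors `a`
such that `g_a` is squarefree over `ℂ`, has degree at least 7, and the number of its
distinct real roots plus (1 if `deg g_a = 7`, else 0) equals `8 − 2k` — i.e. the space
of smooth real binary octic forms with `k` complex-conjugate pairs of roots — is
path-connected. -/
theorem stmt19 (k : ℕ) (hk : k ≤ 3) :
    IsPathConnected
      {a : Fin 9 → ℝ |
        Squarefree ((polyOf a).map (algebraMap ℝ ℂ)) ∧
        7 ≤ (polyOf a).natDegree ∧
        (polyOf a).roots.toFinset.card
            + (if (polyOf a).natDegree = 7 then 1 else 0) = 8 - 2 * k} := by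
  obtain ⟨n, hn⟩ : ∃ n, n + 1 + 2 * k = 8 := ⟨7 - 2 * k, by omega⟩
  have hcont : Continuous fun (w : ℝ × ((Fin (n + 1) → ℝ) × (Fin k → ℂ))) (i : Fin 9) =>
      (bigF w).coeff i := continuous_pi fun i => bigF_cc _
  convert (parSet_pc n k).image hcont using 1
  ext a
  constructor
  · rintro ⟨hsq, hdeg, hcard⟩
    have hsep : (polyOf a).Separable := by
      rw [← separable_map (algebraMap ℝ ℂ)]
      exact PerfectField.separable_iff_squarefree.2 hsq
    have hle := polyOf_natDegree_le a
    obtain ⟨w, hw, hwa⟩ : ∃ w ∈ parSet n k, bigF w = polyOf a := by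
      by_cases h7 : (polyOf a).natDegree = 7
      · rw [if_pos h7] at hcard
        exact surj_aux n k _ hsep 1 (Or.inr rfl) (by omega) (by omega)
      · rw [if_neg h7] at hcard
        exact surj_aux n k _ hsep 0 (Or.inl rfl) (by omega) (by omega)
    refine ⟨w, hw, ?_⟩
    funext i
    simp only [hwa, polyOf_coeff]
  · rintro ⟨w, hw, rfl⟩
    have hb := numF_bounds hw.2.1
    have hd := bigF_natDegree hw
    have hp := polyOf_of_coeff (p := bigF w) (by omega)
    simp only [Set.mem_setOf_eq]
    rw [hp, bigF_roots hw, hd]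
    refine ⟨((separable_map _).2 (bigF_sep hw)).squarefree, by omega, ?_⟩
    split_ifs <;> omega
end
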